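/- Let k = 6. Define the reversion vector R assigning to each triple r < s < t of elements of Fin 6 the polynomial R(r,s,t) = −x_{rs}x_{rt} + x_{rs}x_{st} − x_{rt}x_{st} in ℚ[x_{ij} : 1 ≤ i < j ≤ 6]. There exists a vector Ω, assigning to each triple T = (r,s,t), r < s < t, a polynomial Ω(T) in ℚ[x_{ij} : 1 ≤ i < j ≤ 6], not all zero, such that Σ_T V(i,j)(T) · Ω(T) = 0 for every ordered pair (i,j) of distinct indices in Fin 6, and also Σ_T R(T) · Ω(T) = 0. (This yields the finite type link-homotopy invariant μ·Ω of 6-component links which changes only by a sign when the orientation of every component is reversed, i.e. an invariant detecting invertibility; Section 3 of the paper.) -/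

import Mathlib

noncomputable section

/-- The index set of the commuting indeterminates `x_{ij}`: one for each unordered
pair of distinct indices in `Fin 6`. -/
abbrev LinkingVar := {p : Sym2 (Fin 6) // ¬ p.IsDiag}

/-- The polynomial ring `ℚ[x_{ij} : 1 ≤ i < j ≤ 6]`. -/
abbrev LinkingPoly := MvPolynomial LinkingVar ℚ

/-- The generic linking number `x_{ij} = x_{ji}` attached to the unordered pair
`{i,j}` of distinct indices (junk value `0` when `i = j`). -/
def genericLinking (i j : Fin 6) : LinkingPoly :=
  if h : i = j then 0
  else MvPolynomial.X ⟨s(i, j), by simp [Sym2.mk_isDiag_iff, h]⟩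

/-- The set of triples `r < s < t` of elements of `Fin 6`. -/
abbrev OrderedTriple :=
  {T : Fin 6 × Fin 6 × Fin 6 // T.1 < T.2.1 ∧ T.2.1 < T.2.2}

/-- The partial-conjugation translation vector `V(i,j)` of Lemma 2.5, with values the
generic linking numbers: the change of Milnor's triple linking number `μ(rst)` under
the partial conjugation `i^j`.  It vanishes if `{i,j} ⊄ {r,s,t}`, and on a triple
`r < s < t`: `V(r,s) = x_{rt}`, `V(r,t) = −x_{rs}`, `V(s,r) = −x_{st}`,
`V(s,t) = x_{rs}`, `V(t,r) = x_{st}`, `V(t,s) = −x_{rt}`. -/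
def partialConjVecPoly (i j : Fin 6) (T : OrderedTriple) : LinkingPoly :=
  let r := T.val.1; let s := T.val.2.1; let t := T.val.2.2
  (if i = r ∧ j = s then genericLinking r t else 0) +
  (if i = r ∧ j = t then -(genericLinking r s) else 0) +
  (if i = s ∧ j = r then -(genericLinking s t) else 0) +
  (if i = s ∧ j = t then genericLinking r s else 0) +
  (if i = t ∧ j = r then genericLinking s t else 0) +
  (if i = t ∧ j = s then -(genericLinking r t) else 0)

/-- The reversion vector `R` of Theorem 2.8:
`R(r,s,t) = −x_{rs}x_{rt} + x_{rs}x_{st} − x_{rt}x_{st}`. -/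
def reversionVec (T : OrderedTriple) : LinkingPoly :=
  let r := T.val.1; let s := T.val.2.1; let t := T.val.2.2
  (-(genericLinking r s * genericLinking r t) +
    genericLinking r s * genericLinking s t -
    genericLinking r t * genericLinking s t)

theorem genericLinking_comm (i j : Fin 6) : genericLinking i j = genericLinking j i := by
  unfold genericLinking
  by_cases h : i = j
  · simp [h]
  · simp [h, Ne.symm h, Sym2.eq_swap]

theorem genericLinking_ne_zero {i j : Fin 6} (h : i ≠ j) : genericLinking i j ≠ 0 := by
  simp [genericLinking, h]

/-- The partial conjugations of a fixed component by all of the others compose to a trivial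
change, when weighted by linking numbers. -/
theorem sum_genericLinking_mul_partialConjVecPoly (i : Fin 6) (T : OrderedTriple) :
    ∑ j, genericLinking i j * partialConjVecPoly i j T = 0 := by
  obtain ⟨⟨r, s, t⟩, hrs, hst⟩ := T
  have hrt : r < t := hrs.trans hst
  simp only at hrs hst
  simp only [partialConjVecPoly, mul_add, Finset.sum_add_distrib, ite_and, mul_ite, mul_zero]
  by_cases h₁ : i = r
  · subst h₁
    simp [hrs.ne, hrt.ne]
    ring
  by_cases h₂ : i = s
  · subst h₂
    simp [hrs.ne', hst.ne, genericLinking_comm r i]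
    ring
  by_cases h₃ : i = t
  · subst h₃
    simp [hrt.ne', hst.ne', genericLinking_comm r i, genericLinking_comm s i]
    ring
  simp [h₁, h₂, h₃]

/-- Conjugating every component by a fixed one is trivial. -/
theorem sum_partialConjVecPoly (j : Fin 6) (T : OrderedTriple) :
    ∑ i, partialConjVecPoly i j T = 0 := by
  simp only [partialConjVecPoly, Finset.sum_add_distrib, ite_and, Finset.sum_ite_eq',
    Finset.mem_univ, if_true]
  split_ifs <;> ring

theorem partialConjVecPoly_self (i : Fin 6) (T : OrderedTriple) :
    partialConjVecPoly i i T = 0 := by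
  obtain ⟨⟨r, s, t⟩, hrs, hst⟩ := T
  have hrt : r < t := hrs.trans hst
  simp only at hrs hst
  dsimp only [partialConjVecPoly]
  split_ifs <;> first | omega | simp

/-- The pairs whose translation vectors are determined, over the field of fractions, by the
remaining ones. -/
def redundantPairs : Finset (Fin 6 × Fin 6) :=
  {(0, 2), (0, 3), (1, 2), (1, 3), (4, 2), (5, 2), (3, 2), (2, 3), (0, 4), (0, 5), (1, 0), (0, 1)}

theorem genericLinking_minor_ne_zero :
    genericLinking 0 2 * genericLinking 1 3 - genericLinking 0 3 * genericLinking 1 2 ≠ 0 := by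
  intro h
  have heval := congrArg (MvPolynomial.eval fun v : LinkingVar =>
    if v.1 = s(0, 2) ∨ v.1 = s(1, 3) then (1 : ℚ) else 0) h
  simp [genericLinking] at heval

/-- An array satisfying the weighted row relations and the column relations vanishes as soon as
it vanishes away from `redundantPairs`. -/
theorem eq_zero_of_eq_zero_off_redundantPairs {W : Fin 6 → Fin 6 → LinkingPoly}
    (hrow : ∀ i, ∑ j, genericLinking i j * W i j = 0) (hcol : ∀ j, ∑ i, W i j = 0)
    (hW : ∀ i j, (i, j) ∉ redundantPairs → W i j = 0) (i j : Fin 6) : W i j = 0 := by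
  have W42 : W 4 2 = 0 := by
    simpa +decide [Fin.sum_univ_six, hW, genericLinking_ne_zero] using hrow 4
  have W52 : W 5 2 = 0 := by
    simpa +decide [Fin.sum_univ_six, hW, genericLinking_ne_zero] using hrow 5
  have W32 : W 3 2 = 0 := by
    simpa +decide [Fin.sum_univ_six, hW, genericLinking_ne_zero] using hrow 3
  have W23 : W 2 3 = 0 := by
    simpa +decide [Fin.sum_univ_six, hW, genericLinking_ne_zero] using hrow 2
  have W04 : W 0 4 = 0 := by simpa +decide [Fin.sum_univ_six, hW] using hcol 4
  have W05 : W 0 5 = 0 := by simpa +decide [Fin.sum_univ_six, hW] using hcol 5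
  have W10 : W 1 0 = 0 := by simpa +decide [Fin.sum_univ_six, hW] using hcol 0
  have W01 : W 0 1 = 0 := by simpa +decide [Fin.sum_univ_six, hW] using hcol 1
  have c2 : W 0 2 + W 1 2 = 0 := by
    simpa +decide [Fin.sum_univ_six, hW, W42, W52, W32] using hcol 2
  have c3 : W 0 3 + W 1 3 = 0 := by simpa +decide [Fin.sum_univ_six, hW, W23] using hcol 3
  have r0 : genericLinking 0 2 * W 0 2 + genericLinking 0 3 * W 0 3 = 0 := by
    simpa +decide [Fin.sum_univ_six, hW, W01, W04, W05] using hrow 0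
  have r1 : genericLinking 1 2 * W 1 2 + genericLinking 1 3 * W 1 3 = 0 := by
    simpa +decide [Fin.sum_univ_six, hW, W10] using hrow 1
  have W02 : W 0 2 = 0 := by
    refine (mul_eq_zero.1 ?_).resolve_left genericLinking_minor_ne_zero
    linear_combination genericLinking 1 3 * r0 + genericLinking 0 3 * r1
      - genericLinking 0 3 * genericLinking 1 2 * c2 - genericLinking 0 3 * genericLinking 1 3 * c3
  have W12 : W 1 2 = 0 := by simpa [W02] using c2
  have W03 : W 0 3 = 0 := by simpa [W02, genericLinking_ne_zero] using r0
  have W13 : W 1 3 = 0 := by simpa [W03] using c3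
  by_cases h : (i, j) ∈ redundantPairs
  · simp only [redundantPairs, Finset.mem_insert, Finset.mem_singleton, Prod.mk.injEq] at h
    rcases h with ⟨rfl, rfl⟩ | ⟨rfl, rfl⟩ | ⟨rfl, rfl⟩ | ⟨rfl, rfl⟩ | ⟨rfl, rfl⟩ | ⟨rfl, rfl⟩ |
      ⟨rfl, rfl⟩ | ⟨rfl, rfl⟩ | ⟨rfl, rfl⟩ | ⟨rfl, rfl⟩ | ⟨rfl, rfl⟩ | ⟨rfl, rfl⟩ <;> assumption
  · exact hW i j h

/-- A homogeneous linear system with fewer equations than unknowns over a nontrivial commutative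
ring has a nonzero solution. -/
theorem Matrix.exists_ne_zero_mulVec_eq_zero_of_card_lt {R m n : Type*} [CommRing R]
    [Nontrivial R] [Fintype m] [Fintype n] (A : Matrix m n R)
    (h : Fintype.card m < Fintype.card n) : ∃ v ≠ 0, A.mulVec v = 0 := by
  by_contra! H
  refine h.not_ge (card_le_of_injective R A.mulVecLin ?_)
  rw [injective_iff_map_eq_zero]
  intro v hv
  by_contra hv'
  exact H v hv' hv

/-- Section 3 (`k = 6`): there is a nonzero vector `Ω` of polynomials in the generic
linking numbers, indexed by the triples `r < s < t` of elements of `Fin 6`, which is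
orthogonal to every partial-conjugation translation vector `V(i,j)` and to the
reversion vector `R`.  The resulting invariant `μ·Ω` detects invertibility. -/
theorem exists_perp_to_partialConjVecs_and_reversion :
    ∃ Ω : OrderedTriple → LinkingPoly, Ω ≠ 0 ∧
      (∀ i j : Fin 6, i ≠ j →
        ∑ T : OrderedTriple, partialConjVecPoly i j T * Ω T = 0) ∧
      ∑ T : OrderedTriple, reversionVec T * Ω T = 0 := by
  let A : Matrix (Option {p : Fin 6 × Fin 6 // p.1 ≠ p.2 ∧ p ∉ redundantPairs}) OrderedTriple
      LinkingPoly := fun o T => o.elim (reversionVec T) fun p => partialConjVecPoly p.1.1 p.1.2 T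
  obtain ⟨Ω, hΩ, hA⟩ := A.exists_ne_zero_mulVec_eq_zero_of_card_lt (by decide)
  refine ⟨Ω, hΩ, fun i j _ => ?_, congrFun hA none⟩
  refine eq_zero_of_eq_zero_off_redundantPairs
    (W := fun i j => ∑ T, partialConjVecPoly i j T * Ω T)
    (fun i => ?_) (fun j => ?_) (fun i j h => ?_) i j
  · simp_rw [Finset.mul_sum, ← mul_assoc]
    rw [Finset.sum_comm]
    simp [← Finset.sum_mul, sum_genericLinking_mul_partialConjVecPoly]
  · rw [Finset.sum_comm]
    simp [← Finset.sum_mul, sum_partialConjVecPoly]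
  · by_cases hij : i = j
    · simp [hij, partialConjVecPoly_self]
    · exact congrFun hA (some ⟨(i, j), hij, h⟩)

end
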